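/- Assume N ≥ 2. Suppose δ ≥ 1 is an integer such that ord_0(f_h) ≤ δ for every h ∈ GL_{N+1}(k), and that for every h ∈ GL_{N+1}(k) with ord_0(f_h) = δ, the lowest-degree homogeneous part in_δ(f_h) is not a scalar multiple of x_0^δ (this quantified condition expresses that for every point P ∈ H(k) where H has multiplicity δ, the support of the projective tangent cone P(C_P H) ⊂ P^{N−1}_k is not a projective hyperplane). If d > (N+1)·(δ−1), then for every g ∈ GL_{N+1}(k) and every nonzero α ∈ ℤ^{N+1} with Σ_{i=0}^N α_i = 0, one has deg_α(F∘g) > 0; that is, F satisfies the Hilbert–Mumford criterion for stability, so H is stable. -/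

import Mathlib

open MvPolynomial

/-- The `α`-degree of a multivariate polynomial `G`: the maximum of `∑ i, m i * α i`
over the monomials `X^m` occurring in `G` with nonzero coefficient (0 if `G = 0`). -/
noncomputable def adeg {k : Type*} [CommSemiring k] {n : ℕ} (α : Fin n → ℤ)
    (G : MvPolynomial (Fin n) k) : ℤ :=
  if h : G.support.Nonempty then G.support.sup' h (fun m => ∑ i, (m i : ℤ) * α i) else 0

/-- `F ∘ g`: the polynomial obtained from `F` by the substitution `X i ↦ ∑ j, g i j • X j`. -/
noncomputable def substGL {k : Type*} [CommRing k] {n : ℕ}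
    (g : Matrix (Fin n) (Fin n) k) (F : MvPolynomial (Fin n) k) :
    MvPolynomial (Fin n) k :=
  aeval (fun i => ∑ j, C (g i j) * X j) F

/-- Dehomogenization with respect to the last variable:
`G(X_0, …, X_N) ↦ G(x_0, …, x_{N-1}, 1)`. -/
noncomputable def dehom {k : Type*} [CommRing k] {N : ℕ}
    (G : MvPolynomial (Fin (N+1)) k) : MvPolynomial (Fin N) k :=
  aeval (fun i : Fin (N+1) => if h : (i : ℕ) < N then X ⟨i, h⟩ else 1) G

/-- `ord_0 f`: the minimal total degree of a monomial occurring in `f`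
with nonzero coefficient (0 if `f = 0`). -/
noncomputable def ord0 {k : Type*} [CommSemiring k] {N : ℕ}
    (f : MvPolynomial (Fin N) k) : ℕ :=
  if h : f.support.Nonempty then f.support.inf' h (fun m => ∑ i, m i) else 0

/-- The ideal generated by `F` and its partial derivatives, defining the singular
locus `H_sing` of the hypersurface `H = {F = 0}`. -/
noncomputable def jacobianIdeal {k : Type*} [CommRing k] {N : ℕ}
    (F : MvPolynomial (Fin (N+1)) k) : Ideal (MvPolynomial (Fin (N+1)) k) :=
  Ideal.span ({F} ∪ Set.range (fun i => pderiv i F))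

theorem substGL_mul {k : Type*} [CommRing k] {n : ℕ} (g A : Matrix (Fin n) (Fin n) k)
    (F : MvPolynomial (Fin n) k) : substGL (g * A) F = substGL A (substGL g F) := by
  unfold substGL
  rw [← AlgHom.comp_apply, comp_aeval]
  congr 2
  funext i
  simp only [Matrix.mul_apply, map_sum, map_mul, aeval_X, Finset.mul_sum, Finset.sum_mul,
    algHom_C, algebraMap_eq]
  rw [Finset.sum_comm]
  simp only [mul_assoc]

theorem substGL_one {k : Type*} [CommRing k] {n : ℕ} (F : MvPolynomial (Fin n) k) :
    substGL (1 : Matrix (Fin n) (Fin n) k) F = F := by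
  simp [substGL, Matrix.one_apply]

theorem substGL_ne_zero {k : Type*} [CommRing k] {n : ℕ}
    (g : Matrix.GeneralLinearGroup (Fin n) k) {F : MvPolynomial (Fin n) k} (hF : F ≠ 0) :
    substGL (↑g) F ≠ 0 := by
  intro h
  apply hF
  rw [← substGL_one F, ← Units.mul_inv g, substGL_mul, h, substGL, map_zero]

theorem isHomogeneous_substGL {k : Type*} [CommRing k] {n d : ℕ} (g : Matrix (Fin n) (Fin n) k)
    {F : MvPolynomial (Fin n) k} (hF : F.IsHomogeneous d) : (substGL g F).IsHomogeneous d := by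
  have h := hF.aeval (n := 1) (fun i => ∑ j, C (g i j) * X j)
    (fun i => IsHomogeneous.sum _ _ _ fun j _ => isHomogeneous_C_mul_X _ _)
  rwa [one_mul] at h

theorem homogeneousComponent_substGL {k : Type*} [CommRing k] {n : ℕ} (e : ℕ)
    (A : Matrix (Fin n) (Fin n) k) (f : MvPolynomial (Fin n) k) :
    homogeneousComponent e (substGL A f) = substGL A (homogeneousComponent e f) := by
  conv_lhs => rw [← sum_homogeneousComponent f]
  have hs : ∀ s : Finset ℕ, substGL A (∑ i ∈ s, homogeneousComponent i f) =
      ∑ i ∈ s, substGL A (homogeneousComponent i f) := fun s => by simp [substGL]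
  rw [hs, map_sum]
  simp_rw [homogeneousComponent_of_mem
    (isHomogeneous_substGL A (homogeneousComponent_isHomogeneous _ f))]
  rw [Finset.sum_ite_eq]
  split_ifs with h
  · rfl
  · rw [homogeneousComponent_eq_zero _ f (by simpa [Nat.lt_succ_iff] using h)]
    simp [substGL]

theorem substGL_permMatrix {k : Type*} [CommRing k] {n : ℕ} (σ : Equiv.Perm (Fin n))
    (F : MvPolynomial (Fin n) k) : substGL (σ.permMatrix k) F = rename σ F := by
  unfold substGL
  rw [rename_eq_aeval]
  congr 2
  funext i
  simp [Equiv.Perm.permMatrix, PEquiv.toMatrix_apply, Equiv.toPEquiv_apply]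

/-- The invertible matrix acting as `A` on the first `N` variables and fixing the last one. -/
def extendFixingLast {k : Type*} [CommRing k] {N : ℕ} (A : Matrix (Fin N) (Fin N) k) :
    Matrix (Fin (N + 1)) (Fin (N + 1)) k :=
  (Matrix.fromBlocks A 0 0 (1 : Matrix (Fin 1) (Fin 1) k)).submatrix
    finSumFinEquiv.symm finSumFinEquiv.symm

theorem det_extendFixingLast {k : Type*} [CommRing k] {N : ℕ} (A : Matrix (Fin N) (Fin N) k) :
    (extendFixingLast A).det = A.det := by
  simp [extendFixingLast, Matrix.det_submatrix_equiv_self]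

theorem dehom_substGL_extendFixingLast {k : Type*} [CommRing k] {N : ℕ}
    (A : Matrix (Fin N) (Fin N) k) (G : MvPolynomial (Fin (N + 1)) k) :
    dehom (substGL (extendFixingLast A) G) = substGL A (dehom G) := by
  unfold substGL dehom
  rw [← AlgHom.comp_apply, ← AlgHom.comp_apply, comp_aeval, comp_aeval]
  congr 2
  funext i
  have hc : ∀ j : Fin N, finSumFinEquiv.symm j.castSucc = (Sum.inl j : Fin N ⊕ Fin 1) :=
    fun j => finSumFinEquiv_symm_apply_castAdd j
  have hl : finSumFinEquiv.symm (Fin.last N) = (Sum.inr 0 : Fin N ⊕ Fin 1) :=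
    finSumFinEquiv_symm_apply_natAdd (0 : Fin 1)
  induction i using Fin.lastCases with
  | last => simp [Fin.sum_univ_castSucc, extendFixingLast, hc, hl]
  | cast i => simp [Fin.sum_univ_castSucc, extendFixingLast, hc, hl, algHom_C]

/-- Forgetting the last exponent of a monomial. -/
noncomputable def initExponent {N : ℕ} (m : Fin (N + 1) →₀ ℕ) : Fin N →₀ ℕ :=
  Finsupp.equivFunOnFinite.symm fun i => m i.castSucc

theorem dehom_eq_sum {k : Type*} [CommRing k] {N : ℕ} (G : MvPolynomial (Fin (N + 1)) k) :
    dehom G = ∑ m ∈ G.support, monomial (initExponent m) (coeff m G) := by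
  unfold dehom
  rw [aeval_def, eval₂_eq']
  refine Finset.sum_congr rfl fun m _ => ?_
  rw [monomial_eq, Finsupp.prod_fintype _ _ (by simp), Fin.prod_univ_castSucc]
  simp [initExponent, algebraMap_eq]

theorem exists_mem_support_of_mem_support_dehom {k : Type*} [CommRing k] {N : ℕ}
    {G : MvPolynomial (Fin (N + 1)) k} {p : Fin N →₀ ℕ} (hp : p ∈ (dehom G).support) :
    ∃ m ∈ G.support, initExponent m = p := by
  rw [mem_support_iff, dehom_eq_sum, coeff_sum] at hp
  obtain ⟨m, hm, h⟩ := Finset.exists_ne_zero_of_sum_ne_zero hp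
  refine ⟨m, hm, ?_⟩
  by_contra hne
  exact h (by rw [coeff_monomial, if_neg hne])

theorem dehom_ne_zero {k : Type*} [CommRing k] {N d : ℕ} {G : MvPolynomial (Fin (N + 1)) k}
    (hG : G.IsHomogeneous d) (h0 : G ≠ 0) : dehom G ≠ 0 := by
  obtain ⟨m, hm⟩ := support_nonempty.mpr h0
  have hinj : ∀ m' ∈ G.support, initExponent m' = initExponent m → m' = m := by
    intro m' hm' h
    have hc : ∀ i : Fin N, m' i.castSucc = m i.castSucc := fun i => DFunLike.congr_fun h i
    have h1 : m.degree = d := by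
      rw [Finsupp.degree_eq_weight_one]; exact hG (mem_support_iff.mp hm)
    have h2 : m'.degree = d := by
      rw [Finsupp.degree_eq_weight_one]; exact hG (mem_support_iff.mp hm')
    rw [Finsupp.degree_eq_sum, Fin.sum_univ_castSucc] at h1 h2
    simp only [hc] at h2
    ext i
    induction i using Fin.lastCases with
    | last => omega
    | cast i => exact hc i
  intro h
  have hcoeff := congrArg (coeff (initExponent m)) h
  rw [dehom_eq_sum, coeff_sum, Finset.sum_eq_single m] at hcoeff
  · simp at hcoeff
    exact mem_support_iff.mp hm hcoeff
  · intro m' hm' hne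
    rw [coeff_monomial, if_neg fun h => hne (hinj m' hm' h)]
  · exact fun h => absurd hm h

theorem le_ord0 {k : Type*} [CommSemiring k] {N e : ℕ} {f : MvPolynomial (Fin N) k} (hf : f ≠ 0)
    (h : ∀ p ∈ f.support, e ≤ ∑ i, p i) : e ≤ ord0 f := by
  rw [ord0, dif_pos (support_nonempty.mpr hf)]
  exact Finset.le_inf' _ _ h

theorem exists_mem_support_ord0 {k : Type*} [CommSemiring k] {N : ℕ} {f : MvPolynomial (Fin N) k}
    (hf : f ≠ 0) : ∃ p ∈ f.support, ∑ i, p i = ord0 f := by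
  rw [ord0, dif_pos (support_nonempty.mpr hf)]
  obtain ⟨p, hp, h⟩ := Finset.exists_mem_eq_inf' (support_nonempty.mpr hf) fun m => ∑ i, m i
  exact ⟨p, hp, h.symm⟩

theorem exists_specialLinearGroup_mulVec_eq_smul {k : Type*} [Field k] {n : Type*} [Fintype n]
    [DecidableEq n] {v w : n → k} (hv : v ≠ 0) (hw : w ≠ 0) :
    ∃ (A : Matrix.SpecialLinearGroup n k) (c : k), (A : Matrix n n k).mulVec v = c • w := by
  have : MulAction.IsPretransitive (Matrix.SpecialLinearGroup n k) (Projectivization k (n → k)) :=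
    MulAction.isPretransitive_of_is_two_pretransitive
  obtain ⟨A, hA⟩ := MulAction.exists_smul_eq (Matrix.SpecialLinearGroup n k)
    (Projectivization.mk k v hv) (Projectivization.mk k w hw)
  rw [Projectivization.matrixSpecialLinearGroup_smul_def, Projectivization.smul_mk,
    Projectivization.mk_eq_mk_iff'] at hA
  obtain ⟨c, hc⟩ := hA
  exact ⟨A, c, hc.symm⟩

theorem lt_sum_exponent_mul_weight {N d δ : ℕ} {a : Fin (N + 1) → ℤ} (ha : Monotone a)
    (h0 : a ≠ 0) (hs : ∑ i, a i = 0) (hdeg : ((N : ℤ) + 1) * ((δ : ℤ) - 1) < (d : ℤ))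
    {m : Fin (N + 1) → ℕ} (hm : ∑ i, m i = d) (hle : ∑ i, (m i : ℤ) * a i ≤ 0) :
    ((δ : ℤ) - 1) * ∑ i : Fin N, (a (Fin.last N) - a i.castSucc) <
      ∑ i : Fin N, (m i.castSucc : ℤ) * (a (Fin.last N) - a i.castSucc) := by
  have hpos : 0 < a (Fin.last N) := by
    by_contra! hn
    have hnonpos : ∀ i ∈ Finset.univ, a i ≤ 0 := fun i _ => (ha (Fin.le_last i)).trans hn
    exact h0 (funext fun i => (Finset.sum_eq_zero_iff_of_nonpos hnonpos).mp hs i (Finset.mem_univ i))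
  have hm' : (∑ i : Fin N, (m i.castSucc : ℤ)) + m (Fin.last N) = d := by
    rw [← hm, Fin.sum_univ_castSucc]
    push_cast
    rfl
  rw [Fin.sum_univ_castSucc] at hs hle
  have h1 : ∑ i : Fin N, (a (Fin.last N) - a i.castSucc) = ((N : ℤ) + 1) * a (Fin.last N) := by
    rw [Finset.sum_sub_distrib]
    simp only [Finset.sum_const, Finset.card_univ, Fintype.card_fin, nsmul_eq_mul]
    linarith
  have h2 : ∑ i : Fin N, (m i.castSucc : ℤ) * (a (Fin.last N) - a i.castSucc) =
      (∑ i : Fin N, (m i.castSucc : ℤ)) * a (Fin.last N) -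
        ∑ i : Fin N, (m i.castSucc : ℤ) * a i.castSucc := by
    simp only [mul_sub, Finset.sum_sub_distrib, Finset.sum_mul]
  rw [h1, h2]
  have h3 := mul_lt_mul_of_pos_right hdeg hpos
  rw [← hm'] at h3
  linarith

theorem le_sum_of_lt_sum_mul {ι : Type*} [Fintype ι] {β : ι → ℤ} {j₀ : ι} (hβ : ∀ i, 0 ≤ β i)
    (hmax : ∀ i, β i ≤ β j₀) {p : ι → ℕ} {δ : ℕ}
    (h : ((δ : ℤ) - 1) * ∑ i, β i < ∑ i, (p i : ℤ) * β i) : δ ≤ ∑ i, p i := by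
  by_contra! hlt
  have h1 : ∑ i, (p i : ℤ) * β i ≤ (∑ i, (p i : ℤ)) * β j₀ := by
    rw [Finset.sum_mul]
    exact Finset.sum_le_sum fun i _ => mul_le_mul_of_nonneg_left (hmax i) (by positivity)
  have h2 : (∑ i, (p i : ℤ)) ≤ (δ : ℤ) - 1 := by
    rw [← Nat.cast_sum]
    omega
  have h3 : β j₀ ≤ ∑ i, β i := Finset.single_le_sum (fun i _ => hβ i) (Finset.mem_univ j₀)
  have h4 : (0 : ℤ) ≤ (δ : ℤ) - 1 := by omega
  nlinarith [mul_le_mul_of_nonneg_right h2 (hβ j₀), mul_le_mul_of_nonneg_left h3 h4]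

theorem eq_zero_of_lt_sum_mul {ι : Type*} [Fintype ι] [DecidableEq ι] {β : ι → ℤ} {j₀ : ι}
    (hβ : ∀ i, 0 ≤ β i) (hmax : ∀ i, β i ≤ β j₀) {p : ι → ℕ} {δ : ℕ} (hδ : 2 ≤ δ)
    (h : ((δ : ℤ) - 1) * ∑ i, β i < ∑ i, (p i : ℤ) * β i) (hp : ∑ i, p i = δ) {j : ι}
    (hj : j ≠ j₀) : p j = 0 := by
  by_contra hpj
  have hpj' : (1 : ℤ) ≤ p j := by exact_mod_cast Nat.one_le_iff_ne_zero.mpr hpj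
  have h1 : ∑ i, (p i : ℤ) * β i = (δ : ℤ) * β j₀ - ∑ i, (p i : ℤ) * (β j₀ - β i) := by
    simp only [mul_sub, Finset.sum_sub_distrib, ← Finset.sum_mul]
    rw [← Nat.cast_sum, hp]
    ring
  have h2 : (p j : ℤ) * (β j₀ - β j) ≤ ∑ i, (p i : ℤ) * (β j₀ - β i) :=
    Finset.single_le_sum (f := fun i => (p i : ℤ) * (β j₀ - β i))
      (fun i _ => mul_nonneg (by positivity) (sub_nonneg.mpr (hmax i))) (Finset.mem_univ j)
  have h3 : β j + β j₀ ≤ ∑ i, β i := by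
    rw [← Finset.sum_pair hj]
    exact Finset.sum_le_sum_of_subset_of_nonneg (Finset.subset_univ _) fun i _ _ => hβ i
  have h4 : (1 : ℤ) ≤ (δ : ℤ) - 1 := by omega
  nlinarith [mul_le_mul_of_nonneg_right hpj' (sub_nonneg.mpr (hmax j)),
    mul_le_mul_of_nonneg_left h3 (zero_le_one.trans h4), mul_le_mul_of_nonneg_right h4 (hβ j)]

theorem sum_mul_le_adeg {k : Type*} [CommSemiring k] {n : ℕ} (α : Fin n → ℤ)
    {G : MvPolynomial (Fin n) k} {m : Fin n →₀ ℕ} (hm : m ∈ G.support) :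
    ∑ i, (m i : ℤ) * α i ≤ adeg α G := by
  rw [adeg, dif_pos ⟨m, hm⟩]
  exact Finset.le_sup' (fun m : Fin n →₀ ℕ => ∑ i, (m i : ℤ) * α i) hm

theorem exists_monotone_weight {k : Type*} [Field k] {n : ℕ} (F : MvPolynomial (Fin n) k)
    (g : Matrix.GeneralLinearGroup (Fin n) k) (α : Fin n → ℤ) :
    ∃ (h : Matrix.GeneralLinearGroup (Fin n) k) (σ : Equiv.Perm (Fin n)), Monotone (α ∘ σ) ∧
      ∀ m ∈ (substGL (↑h) F).support, ∑ i, (m i : ℤ) * (α ∘ σ) i ≤ adeg α (substGL (↑g) F) := by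
  set σ := Tuple.sort α
  have hdet : (Equiv.Perm.permMatrix k σ.symm).det ≠ 0 := by
    rw [Matrix.det_permutation]
    rcases Int.units_eq_one_or (Equiv.Perm.sign σ.symm) with h | h <;> simp [h]
  refine ⟨g * Matrix.GeneralLinearGroup.mkOfDetNeZero _ hdet, σ, Tuple.monotone_sort α, ?_⟩
  intro m hm
  have hmul : ((g * Matrix.GeneralLinearGroup.mkOfDetNeZero _ hdet :
      Matrix.GeneralLinearGroup (Fin n) k) : Matrix (Fin n) (Fin n) k) =
      (g : Matrix (Fin n) (Fin n) k) * Equiv.Perm.permMatrix k σ.symm := rfl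
  rw [hmul, substGL_mul, substGL_permMatrix,
    support_rename_of_injective σ.symm.injective, Finset.mem_image] at hm
  obtain ⟨m₀, hm₀, rfl⟩ := hm
  refine le_trans (le_of_eq ?_) (sum_mul_le_adeg α hm₀)
  rw [← Equiv.sum_comp σ fun i => (m₀ i : ℤ) * α i]
  simp [Finsupp.mapDomain_equiv_apply]

theorem exists_homogeneousComponent_one_eq {k : Type*} [Field k] {N : ℕ}
    {f : MvPolynomial (Fin N) k} (hf : homogeneousComponent 1 f ≠ 0) (j₀ : Fin N) :
    ∃ (A : Matrix.SpecialLinearGroup (Fin N) k) (c : k),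
      homogeneousComponent 1 (substGL (A : Matrix (Fin N) (Fin N) k) f) = C c * X j₀ := by
  have hlin : homogeneousComponent 1 f = ∑ i, C (coeff (Finsupp.single i 1) f) * X i := by
    ext p
    rw [coeff_homogeneousComponent, coeff_sum]
    simp only [coeff_C_mul, coeff_X]
    split_ifs with hp
    · obtain ⟨i, rfl⟩ := (Finsupp.sum_eq_one_iff p).mp hp
      simp [Finsupp.single_left_inj]
    · symm
      refine Finset.sum_eq_zero fun i _ => ?_
      rw [if_neg, mul_zero]
      rintro rfl
      exact hp (by simp)
  set v : Fin N → k := fun i => coeff (Finsupp.single i 1) f with hv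
  have hv0 : v ≠ 0 := by
    intro h
    apply hf
    rw [hlin]
    refine Finset.sum_eq_zero fun i _ => ?_
    have := congrFun h i
    simp only [hv, Pi.zero_apply] at this
    simp [this]
  obtain ⟨B, c, hB⟩ := exists_specialLinearGroup_mulVec_eq_smul hv0
    (w := Pi.single j₀ 1) (by simp)
  refine ⟨B.transpose, c, ?_⟩
  rw [homogeneousComponent_substGL, hlin]
  have hB' : ∀ j, ∑ i, v i * B j i = if j = j₀ then c else 0 := by
    intro j
    have := congrFun hB j
    simpa [Matrix.mulVec, dotProduct, Pi.single_apply, mul_comm] using this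
  calc substGL (B.transpose : Matrix (Fin N) (Fin N) k) (∑ i, C (v i) * X i)
      = ∑ j, C (∑ i, v i * B j i) * X j := by
        simp only [substGL, map_sum, map_mul, aeval_X, algHom_C, algebraMap_eq, Finset.mul_sum,
          Finset.sum_mul, Matrix.SpecialLinearGroup.coe_transpose, Matrix.transpose_apply]
        rw [Finset.sum_comm]
        simp only [mul_assoc]
    _ = C c * X j₀ := by simp [hB', apply_ite C, ite_mul]

/-- Assume `N ≥ 2`. If the multiplicity of `H = {F = 0}` at every point is at most `δ`,
at every point of multiplicity exactly `δ` the lowest-degree homogeneous part of the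
local equation is not a scalar multiple of `x_0^δ` (i.e. the support of the projective
tangent cone is not a projective hyperplane), and `d > (N+1)·(δ-1)`, then `F` satisfies
the Hilbert–Mumford criterion for stability, i.e. `H` is stable. -/
theorem stable_of_tangentCone_support_not_hyperplane {k : Type*} [Field k]
    [IsAlgClosed k] {N d : ℕ} (hN : 2 ≤ N) (hd : 2 ≤ d)
    (F : MvPolynomial (Fin (N+1)) k) (hF0 : F ≠ 0) (hFhom : F.IsHomogeneous d)
    (δ : ℕ) (hδ : 1 ≤ δ)
    (hmult : ∀ h : Matrix.GeneralLinearGroup (Fin (N+1)) k,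
      ord0 (dehom (substGL (↑h) F)) ≤ δ)
    (hplane : ∀ h : Matrix.GeneralLinearGroup (Fin (N+1)) k,
      ord0 (dehom (substGL (↑h) F)) = δ → ∀ c : k,
        MvPolynomial.homogeneousComponent δ (dehom (substGL (↑h) F))
          ≠ MvPolynomial.C c * (MvPolynomial.X (⟨0, by omega⟩ : Fin N)) ^ δ)
    (hdeg : ((N : ℤ) + 1) * ((δ : ℤ) - 1) < (d : ℤ)) :
    ∀ g : Matrix.GeneralLinearGroup (Fin (N+1)) k, ∀ α : Fin (N+1) → ℤ,
      α ≠ 0 → (∑ i, α i) = 0 → 0 < adeg α (substGL (↑g) F) := by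
  intro g α hα hsum
  by_contra! hneg
  obtain ⟨h, σ, hmono, hle⟩ := exists_monotone_weight F g α
  set a := α ∘ σ
  have ha0 : a ≠ 0 := fun h0 => hα (funext fun i => by
    simpa [a] using congrFun h0 (σ.symm i))
  have has : ∑ i, a i = 0 := by rw [← hsum]; exact Equiv.sum_comp σ α
  have hhom := isHomogeneous_substGL (h : Matrix (Fin (N + 1)) (Fin (N + 1)) k) hFhom
  set f := dehom (substGL (↑h) F) with hf
  have hf0 : f ≠ 0 := dehom_ne_zero hhom (substGL_ne_zero h hF0)
  set j₀ : Fin N := ⟨0, by omega⟩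
  set β : Fin N → ℤ := fun i => a (Fin.last N) - a i.castSucc
  have hβ : ∀ i, 0 ≤ β i := fun i => sub_nonneg.mpr (hmono (Fin.le_last _))
  have hmax : ∀ i, β i ≤ β j₀ := fun i =>
    sub_le_sub_left (hmono (Fin.castSucc_le_castSucc_iff.mpr (Nat.zero_le i.val))) _
  have hlt : ∀ p ∈ f.support, ((δ : ℤ) - 1) * ∑ i, β i < ∑ i, (p i : ℤ) * β i := by
    intro p hp
    obtain ⟨m, hm, rfl⟩ := exists_mem_support_of_mem_support_dehom hp
    refine lt_sum_exponent_mul_weight hmono ha0 has hdeg ?_ ((hle m hm).trans hneg)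
    refine (Finsupp.degree_eq_sum m).symm.trans ?_
    rw [Finsupp.degree_eq_weight_one]
    exact hhom (mem_support_iff.mp hm)
  have hδle : ∀ p ∈ f.support, δ ≤ ∑ i, p i := fun p hp =>
    le_sum_of_lt_sum_mul hβ hmax (hlt p hp)
  have hord : ord0 f = δ := le_antisymm (hmult h) (le_ord0 hf0 hδle)
  rcases hδ.eq_or_lt with rfl | hδ2
  · obtain ⟨q, hq, hqs⟩ := exists_mem_support_ord0 hf0
    rw [hord] at hqs
    have hcomp : homogeneousComponent 1 f ≠ 0 := by
      intro h0
      have := congrArg (coeff q) h0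
      rw [coeff_homogeneousComponent, if_pos (by rw [Finsupp.degree_eq_sum, hqs]),
        coeff_zero] at this
      exact mem_support_iff.mp hq this
    obtain ⟨A, c, hA⟩ := exists_homogeneousComponent_one_eq hcomp j₀
    have hdet : (extendFixingLast (A : Matrix (Fin N) (Fin N) k)).det ≠ 0 := by
      rw [det_extendFixingLast, A.det_coe]
      exact one_ne_zero
    set h' := h * Matrix.GeneralLinearGroup.mkOfDetNeZero _ hdet
    have hf' : dehom (substGL (h' : Matrix (Fin (N + 1)) (Fin (N + 1)) k) F) =
        substGL (A : Matrix (Fin N) (Fin N) k) f := by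
      rw [hf, ← dehom_substGL_extendFixingLast, ← substGL_mul]
      rfl
    refine hplane h' ?_ c (by rw [hf', hA, pow_one])
    have hne : dehom (substGL (h' : Matrix (Fin (N + 1)) (Fin (N + 1)) k) F) ≠ 0 :=
      dehom_ne_zero (isHomogeneous_substGL _ hFhom) (substGL_ne_zero h' hF0)
    refine le_antisymm (hmult h') (le_ord0 hne fun p hp => ?_)
    by_contra! hp1
    have hdeg0 : p.degree = 0 := by rw [Finsupp.degree_eq_sum]; omega
    obtain rfl := (Finsupp.degree_eq_zero_iff p).mp hdeg0
    have hf00 : coeff 0 f = 0 := by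
      by_contra hc
      have := hδle 0 (mem_support_iff.mpr hc)
      simp at this
    have h0 := homogeneousComponent_substGL 0 (A : Matrix (Fin N) (Fin N) k) f
    rw [homogeneousComponent_zero, homogeneousComponent_zero, hf00, ← hf'] at h0
    refine mem_support_iff.mp hp ?_
    simpa [substGL] using h0
  · refine hplane h hord (coeff (Finsupp.single j₀ δ) f) ?_
    rw [C_mul_X_pow_eq_monomial]
    ext p
    rw [coeff_homogeneousComponent, coeff_monomial]
    by_cases hps : Finsupp.single j₀ δ = p
    · subst hps
      simp [hf]
    rw [if_neg hps]
    split_ifs with hpd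
    · by_contra hpc
      rw [Finsupp.degree_eq_sum] at hpd
      have hz : ∀ j, j ≠ j₀ → p j = 0 := fun j hj =>
        eq_zero_of_lt_sum_mul hβ hmax hδ2 (hlt p (mem_support_iff.mpr hpc)) hpd hj
      apply hps
      rw [Finset.sum_eq_single j₀ (fun j _ hj => hz j hj) (by simp)] at hpd
      ext j
      by_cases hj : j = j₀
      · simp [hj, hpd]
      · simp [hj, hz j hj]
    · rfl
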